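/- Suppose the vectors Δx : Fin n → ℝ and Δs, Δy : Fin m → ℝ satisfy the reduced KKT system: (W + δw • 1 + Σx).mulVec Δx + Aᵀ.mulVec Δy = qx, (Σs + δw • 1).mulVec Δs - Δy = qs, and A.mulVec Δx - Δs - δc • Δy = qy. Then Δx satisfies the condensed KKT system M_cond.mulVec Δx = qx + Aᵀ.mulVec (C.mulVec qs + D.mulVec qy), and moreover Δs = C.mulVec (δc • qs + A.mulVec Δx - qy) and Δy = (Σs + δw • 1).mulVec Δs - qs. -/

import Mathlib

open Matrix

/-- `C := (δc • Σs + (1 + δc*δw) • 1)⁻¹` from the condensed-space IPM. -/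
noncomputable def Cmat (m : ℕ) (δw δc : ℝ) (σs : Fin m → ℝ) : Matrix (Fin m) (Fin m) ℝ :=
  (δc • Matrix.diagonal σs + (1 + δc * δw) • (1 : Matrix (Fin m) (Fin m) ℝ))⁻¹

/-- `D := (Σs + δw • 1) * C`. -/
noncomputable def Dmat (m : ℕ) (δw δc : ℝ) (σs : Fin m → ℝ) : Matrix (Fin m) (Fin m) ℝ :=
  (Matrix.diagonal σs + δw • (1 : Matrix (Fin m) (Fin m) ℝ)) * Cmat m δw δc σs

/-- The condensed KKT matrix `M_cond := W + δw • 1 + Σx + Aᵀ * D * A`. -/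
noncomputable def Mcond (n m : ℕ) (W : Matrix (Fin n) (Fin n) ℝ)
    (A : Matrix (Fin m) (Fin n) ℝ) (δw δc : ℝ) (σx : Fin n → ℝ) (σs : Fin m → ℝ) :
    Matrix (Fin n) (Fin n) ℝ :=
  W + δw • (1 : Matrix (Fin n) (Fin n) ℝ) + Matrix.diagonal σx + Aᵀ * Dmat m δw δc σs * A

/-- `C` is diagonal, with the reciprocals of the diagonal entries it inverts. -/
lemma Cmat_eq_diagonal {m : ℕ} {δw δc : ℝ} {σs : Fin m → ℝ}
    (h : ∀ j, δc * σs j + (1 + δc * δw) ≠ 0) :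
    Cmat m δw δc σs = diagonal fun j => (δc * σs j + (1 + δc * δw))⁻¹ := by
  refine Matrix.inv_eq_right_inv ?_
  rw [← diagonal_one, ← diagonal_smul, ← diagonal_smul, diagonal_add, diagonal_mul_diagonal]
  congr 1
  funext j
  simpa using mul_inv_cancel₀ (h j)

/-- `Σs + δw • 1` is diagonal, with entries `σs j + δw`. -/
lemma diagonal_add_smul_one {m : ℕ} (δw : ℝ) (σs : Fin m → ℝ) :
    diagonal σs + δw • (1 : Matrix (Fin m) (Fin m) ℝ) = diagonal fun j => σs j + δw := by
  rw [← diagonal_one, ← diagonal_smul, diagonal_add]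
  simp

theorem stmt_4 (n m : ℕ) (W : Matrix (Fin n) (Fin n) ℝ) (hW : W.IsSymm)
    (A : Matrix (Fin m) (Fin n) ℝ) (δw δc : ℝ) (hδw : 0 < δw) (hδc : 0 < δc)
    (σx : Fin n → ℝ) (hσx : ∀ i, 0 < σx i) (σs : Fin m → ℝ) (hσs : ∀ j, 0 < σs j)
    (qx : Fin n → ℝ) (qs qy : Fin m → ℝ)
    (Δx : Fin n → ℝ) (Δs Δy : Fin m → ℝ)
    (h1 : (W + δw • (1 : Matrix (Fin n) (Fin n) ℝ) + Matrix.diagonal σx).mulVec Δx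
            + Aᵀ.mulVec Δy = qx)
    (h2 : (Matrix.diagonal σs + δw • (1 : Matrix (Fin m) (Fin m) ℝ)).mulVec Δs - Δy = qs)
    (h3 : A.mulVec Δx - Δs - δc • Δy = qy) :
    (Mcond n m W A δw δc σx σs).mulVec Δx
        = qx + Aᵀ.mulVec ((Cmat m δw δc σs).mulVec qs + (Dmat m δw δc σs).mulVec qy) ∧
    Δs = (Cmat m δw δc σs).mulVec (δc • qs + A.mulVec Δx - qy) ∧
    Δy = (Matrix.diagonal σs + δw • (1 : Matrix (Fin m) (Fin m) ℝ)).mulVec Δs - qs := by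
  have hK : ∀ j, δc * σs j + (1 + δc * δw) ≠ 0 := fun j => by
    have := hσs j
    positivity
  have hΔy : Δy = (diagonal σs + δw • (1 : Matrix (Fin m) (Fin m) ℝ)).mulVec Δs - qs := by
    rw [← h2, sub_sub_cancel]
  have hΔs : Δs = (Cmat m δw δc σs).mulVec (δc • qs + A.mulVec Δx - qy) := by
    rw [Cmat_eq_diagonal hK, ← h3, ← h2, diagonal_add_smul_one]
    funext j
    simp only [mulVec_diagonal, Pi.add_apply, Pi.sub_apply, Pi.smul_apply, smul_eq_mul]
    linear_combination -(Δs j) * mul_inv_cancel₀ (hK j)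
  have hD : (Dmat m δw δc σs).mulVec (A.mulVec Δx) - Δy
      = (Cmat m δw δc σs).mulVec qs + (Dmat m δw δc σs).mulVec qy := by
    rw [hΔy, hΔs, Dmat, Cmat_eq_diagonal hK, diagonal_add_smul_one, diagonal_mul_diagonal]
    funext j
    simp only [mulVec_diagonal, Pi.add_apply, Pi.sub_apply, Pi.smul_apply, smul_eq_mul]
    linear_combination -(qs j) * mul_inv_cancel₀ (hK j)
  refine ⟨?_, hΔs, hΔy⟩
  rw [← hD, ← h1, Mcond, add_mulVec _ (Aᵀ * _ * A), ← mulVec_mulVec, ← mulVec_mulVec,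
    mulVec_sub]
  abel
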